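/- Let V be a uniformly local OPE-algebra with uniform locality data {r_{bc}, 𝐡_{bc}^k} for F_Y, let a, a¹,…,aʳ∈V be homogeneous, and let {c^α}, with exponents 𝐡_{ij}^k = 𝐡_{a^i a^j}^k, be a reduced OPE witnessing the multiple locality of a¹(𝐳),…,aʳ(𝐳) with c^α(𝐳₁,…,𝐳ᵣ)1 ∈ V[[𝐳₁,…,𝐳ᵣ]]. Then for every α: c^α(𝐳₁,…,𝐳ᵣ)a ∈ Σ_{κ∈Π_{i∈[r]}[r_{a^i a}]} 𝐳₁^{−𝐡_{a¹a}^{κ(1)}}⋯𝐳ᵣ^{−𝐡_{aʳa}^{κ(r)}}·V[[𝐳₁,…,𝐳ᵣ]]. -/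

import Mathlib

open scoped BigOperators Classical

noncomputable section

namespace OPEA

variable (K : Type*) [Field K] [CharZero K]

/-- index pairs 𝐧 = (n, n̄) ∈ K² -/
abbrev Idx := K × K

def IsInt (x : K) : Prop := ∃ k : ℤ, (k : K) = x

def IsNegInt (x : K) : Prop := ∃ k : ℤ, k < 0 ∧ (k : K) = x

/-- 𝕂̄ = {𝐧 ∈ K² | n − n̄ ∈ ℤ} -/
def Kbar (n : Idx K) : Prop := IsInt K (n.1 - n.2)

def IsIntPair (n : Idx K) : Prop := IsInt K n.1 ∧ IsInt K n.2

/-- generalized binomial coefficient C(x,k) -/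
def gchoose (x : K) (k : ℕ) : K :=
  (∏ i ∈ Finset.range k, (x - (i : K))) / (k.factorial : K)

/-- (−1)^x for x an integer image in K (and 1 otherwise) -/
def negOnePow (x : K) : K :=
  if h : ∃ k : ℤ, (k : K) = x then (-1 : K) ^ h.choose else 1

variable (M : Type*) [AddCommGroup M] [Module K M]

/-- M-valued distribution in one variable pair -/
abbrev Dist1 := Idx K → M

/-- M-valued distribution in two variable pairs -/
abbrev Dist2 := Idx K → Idx K → M

/-- M-valued distribution in r variable pairs -/
abbrev DistN (r : ℕ) := (Fin r → Idx K) → M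

/-- membership in M[[𝐳]] -/
def IsPow1 (a : Dist1 K M) : Prop := ∀ n, a n ≠ 0 → IsNegInt K n.1 ∧ IsNegInt K n.2

/-- membership in M⌊𝐳⌋ -/
def InLat1 (a : Dist1 K M) : Prop :=
  ∃ S : Finset (Idx K), ∀ n, a n ≠ 0 →
    ∃ m ∈ S, IsNegInt K (n.1 - m.1) ∧ IsNegInt K (n.2 - m.2)

/-- membership in M[[𝐳,𝐰]] -/
def IsPow2 (a : Dist2 K M) : Prop :=
  ∀ n k, a n k ≠ 0 →
    (IsNegInt K n.1 ∧ IsNegInt K n.2) ∧ (IsNegInt K k.1 ∧ IsNegInt K k.2)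

/-- membership in M⌊𝐳,𝐰⌋ -/
def InLat2 (a : Dist2 K M) : Prop :=
  ∃ S : Finset (Idx K × Idx K), ∀ n k, a n k ≠ 0 →
    ∃ m ∈ S, (IsNegInt K (n.1 - m.1.1) ∧ IsNegInt K (n.2 - m.1.2)) ∧
      (IsNegInt K (k.1 - m.2.1) ∧ IsNegInt K (k.2 - m.2.2))

/-- membership in M[[𝐳₁,…,𝐳ᵣ]] -/
def IsPowN {r : ℕ} (a : DistN K M r) : Prop :=
  ∀ n, a n ≠ 0 → ∀ i, IsNegInt K (n i).1 ∧ IsNegInt K (n i).2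

/-- membership in M⌊𝐳₁,…,𝐳ᵣ⌋ -/
def InLatN {r : ℕ} (a : DistN K M r) : Prop :=
  ∃ S : Finset (Fin r → Idx K), ∀ n, a n ≠ 0 →
    ∃ m ∈ S, ∀ i, IsNegInt K ((n i).1 - (m i).1) ∧ IsNegInt K ((n i).2 - (m i).2)

/-- ∂_z -/
def dz (a : Dist1 K M) : Dist1 K M := fun n => (-n.1) • a (n.1 - 1, n.2)

/-- ∂_z̄ -/
def dzb (a : Dist1 K M) : Dist1 K M := fun n => (-n.2) • a (n.1, n.2 - 1)

/-- ∂ in the first variable pair of a two-variable distribution (z-component) -/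
def d1z (c : Dist2 K M) : Dist2 K M := fun n k => (-n.1) • c (n.1 - 1, n.2) k

/-- ∂ in the first variable pair of a two-variable distribution (z̄-component) -/
def d1zb (c : Dist2 K M) : Dist2 K M := fun n k => (-n.2) • c (n.1, n.2 - 1) k

/-- divided power d^{(x)} of an operator d, for a K-valued exponent x
(zero unless x ∈ ℕ) -/
def dPow {A : Type*} [AddCommGroup A] [Module K A] (d : A → A) (x : K) (a : A) : A :=
  if h : ∃ j : ℕ, (j : K) = x then ((h.choose.factorial : K))⁻¹ • d^[h.choose] a else 0

/-- ∂_z^{(e_1)} ∂_z̄^{(e_2)} in the first variable pair -/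
def ddPow2 (e : Idx K) (c : Dist2 K M) : Dist2 K M :=
  dPow K (d1z K M) e.1 (dPow K (d1zb K M) e.2 c)

/-- the diagonal map c(𝐳,𝐰) ↦ c(𝐰,𝐰) -/
def diag (c : Dist2 K M) : Dist1 K M :=
  fun n => ∑ᶠ m : Idx K, c m (n.1 - m.1 - 1, n.2 - m.2 - 1)

/-- multiplication by (𝐳−𝐰)^h (expansion in z>w), on coefficients;
first index is 𝐳, second is 𝐰 -/
def zwPow (h : Idx K) (c : Dist2 K M) : Dist2 K M :=
  fun m k => ∑ᶠ i : ℕ × ℕ,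
    ((-1 : K) ^ (i.1 + i.2) * gchoose K h.1 i.1 * gchoose K h.2 i.2) •
      c (m.1 + h.1 - i.1, m.2 + h.2 - i.2) (k.1 + i.1, k.2 + i.2)

/-- multiplication by ((𝐳−𝐰)_{w>z})^h = (−1)^h (𝐰−𝐳)^h (expansion in w>z) -/
def zwPowW (h : Idx K) (c : Dist2 K M) : Dist2 K M :=
  fun m k => ∑ᶠ i : ℕ × ℕ,
    (negOnePow K (h.1 - h.2) * (-1 : K) ^ (i.1 + i.2) *
        gchoose K h.1 i.1 * gchoose K h.2 i.2) •
      c (m.1 + i.1, m.2 + i.2) (k.1 + h.1 - i.1, k.2 + h.2 - i.2)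

/-- multiplication by (𝐱+𝐰)^N of a distribution d(𝐰,𝐱) (first index 𝐰, second 𝐱);
the result is indexed by (x-index, w-index) -/
def xwPow (N : Idx K) (d : Dist2 K M) : Dist2 K M :=
  fun m k => ∑ᶠ i : ℕ × ℕ, (gchoose K N.1 i.1 * gchoose K N.2 i.2) •
    d (k.1 + i.1, k.2 + i.2) (m.1 + N.1 - i.1, m.2 + N.2 - i.2)

/-- multiplication by (𝐰+𝐱)^N of a distribution d(𝐰,𝐱) (first index 𝐰, second 𝐱);
the result is indexed by (x-index, w-index) -/
def wxPow (N : Idx K) (d : Dist2 K M) : Dist2 K M :=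
  fun m k => ∑ᶠ i : ℕ × ℕ, (gchoose K N.1 i.1 * gchoose K N.2 i.2) •
    d (k.1 + N.1 - i.1, k.2 + N.2 - i.2) (m.1 + i.1, m.2 + i.2)

/-- multiplication by 𝐱^A 𝐰^B (𝐱+𝐰)^N of p(𝐰,𝐱); result indexed (x-index, w-index) -/
def tripleXW (A B N : Idx K) (p : Dist2 K M) : Dist2 K M :=
  fun m k => ∑ᶠ l : ℕ × ℕ, (gchoose K N.1 l.1 * gchoose K N.2 l.2) •
    p (k.1 + B.1 + l.1, k.2 + B.2 + l.2) (m.1 + A.1 + N.1 - l.1, m.2 + A.2 + N.2 - l.2)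

/-- multiplication by 𝐱^A 𝐰^B (𝐰+𝐱)^N of p(𝐰,𝐱); result indexed (x-index, w-index) -/
def tripleWX (A B N : Idx K) (p : Dist2 K M) : Dist2 K M :=
  fun m k => ∑ᶠ l : ℕ × ℕ, (gchoose K N.1 l.1 * gchoose K N.2 l.2) •
    p (k.1 + B.1 + N.1 - l.1, k.2 + B.2 + N.2 - l.2) (m.1 + A.1 + l.1, m.2 + A.2 + l.2)

variable (E : Type*) [AddCommGroup E] [Module K E]

/-- End(E)-valued distributions in one variable pair -/
abbrev EDist1 := Dist1 K (Module.End K E)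

/-- End(E)-valued distributions in two variable pairs -/
abbrev EDist2 := Dist2 K (Module.End K E)

/-- End(E)-valued distributions in r variable pairs -/
abbrev EDistN (r : ℕ) := DistN K (Module.End K E) r

def ev1 (a : EDist1 K E) (v : E) : Dist1 K E := fun n => a n v

def ev2 (c : EDist2 K E) (v : E) : Dist2 K E := fun n k => c n k v

def evN {r : ℕ} (c : EDistN K E r) (v : E) : DistN K E r := fun n => c n v

/-- a(𝐳) is a field -/
def IsFieldD (a : EDist1 K E) : Prop := ∀ v, InLat1 K E (ev1 K E a v)

/-- a field in two variable pairs -/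
def IsField2D (c : EDist2 K E) : Prop := ∀ v, InLat2 K E (ev2 K E c v)

/-- the Koszul sign (−1)^{pq} -/
def koszul (p q : ZMod 2) : K := if p = 1 ∧ q = 1 then (-1 : K) else 1

/-- the data (c^i, 𝐡_i) is an OPE of the homogeneous distributions a(𝐳), b(𝐳)
of parities pa, pb (all identities to be read applied to each vector of E) -/
def IsOPE (pa pb : ZMod 2) (a b : EDist1 K E) {r : ℕ}
    (c : Fin r → EDist2 K E) (h : Fin r → Idx K) : Prop :=
  (∀ i, Kbar K (h i)) ∧ (∀ i, IsField2D K E (c i)) ∧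
  (∀ v m k, a m (b k v) = ∑ i, zwPow K E (-(h i)) (ev2 K E (c i) v) m k) ∧
  (∀ v m k, koszul K pa pb • (b k (a m v)) =
      ∑ i, zwPowW K E (-(h i)) (ev2 K E (c i) v) m k)

/-- a(𝐳), b(𝐳) (homogeneous of parities pa, pb) are local -/
def IsLocal (pa pb : ZMod 2) (a b : EDist1 K E) : Prop :=
  ∃ (r : ℕ) (c : Fin r → EDist2 K E) (h : Fin r → Idx K), IsOPE K E pa pb a b c h

/-- the exponents of an OPE are reduced: 𝐡_i ∉ 𝐡_j + ℤ² for i ≠ j -/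
def ReducedExp {r : ℕ} (h : Fin r → Idx K) : Prop :=
  ∀ i j, i ≠ j → ¬ IsIntPair K (h i - h j)

/-- the product field a(𝐰)_{(𝐧)}b(𝐰) built from an OPE (c,h), applied to a vector v -/
def prodAt {r : ℕ} (c : Fin r → EDist2 K E) (h : Fin r → Idx K) (n : Idx K)
    (v : E) : Dist1 K E :=
  fun m => ∑ i, diag K E
    (ddPow2 K E ((h i).1 - 1 - n.1, (h i).2 - 1 - n.2) (ev2 K E (c i) v)) m

/-- s₁ : a(𝐳) ↦ a_{(−1,−1)}1 -/
def s1 (one : E) (a : EDist1 K E) : E := a ((-1 : K), (-1 : K)) one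

/-- the distribution d (to be thought of as a(𝐳)1) equals
Σ_{𝐢∈ℕ²} T^{(i)} T̄^{(ī)} (d_{(−1,−1)}) 𝐳^𝐢, i.e. a(𝐳) is creative -/
def CreativeD (T Tb : Module.End K E) (d : Dist1 K E) : Prop :=
  (∀ i : ℕ × ℕ, d (-(i.1 : K) - 1, -(i.2 : K) - 1) =
      ((i.1.factorial : K)⁻¹ * (i.2.factorial : K)⁻¹) •
        ((T ^ i.1) * (Tb ^ i.2)) (d ((-1 : K), (-1 : K)))) ∧
  (∀ n : Idx K, (¬ ∃ i : ℕ × ℕ, n = (-(i.1 : K) - 1, -(i.2 : K) - 1)) → d n = 0)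

/-- a(𝐳) is translation covariant for (T, T̄) -/
def TransCov (T Tb : Module.End K E) (a : EDist1 K E) : Prop :=
  (∀ n : Idx K, T * a n - a n * T = (-n.1) • a (n.1 - 1, n.2)) ∧
  (∀ n : Idx K, Tb * a n - a n * Tb = (-n.2) • a (n.1, n.2 - 1))

/-- translation covariance of a product field, per vector -/
def TransCovAt (T Tb : Module.End K E) (P : E → Dist1 K E) : Prop :=
  (∀ v (m : Idx K), T (P v m) - P (T v) m = (-m.1) • P v (m.1 - 1, m.2)) ∧
  (∀ v (m : Idx K), Tb (P v m) - P (Tb v) m = (-m.2) • P v (m.1, m.2 - 1))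

/-- the identity field 1(z) = id_E -/
def idField : EDist1 K E :=
  fun n => if n = ((-1 : K), (-1 : K)) then (1 : Module.End K E) else 0

/-- pairs i < j in [r] -/
abbrev Pairs (r : ℕ) := {p : Fin r × Fin r // p.1 < p.2}

/-- the index shift of the i-th variable produced by the monomial of a binomial
expansion of ((𝐳_{p₁} − 𝐳_{p₂})_σ)^h belonging to 𝐤 ∈ ℕ² -/
def pairShift {r : ℕ} (p : Pairs r) (h : Idx K) (flip : Bool) (kk : ℕ × ℕ)
    (i : Fin r) : Idx K :=
  if i = p.1.1 then
    (if flip then ((kk.1 : K), (kk.2 : K)) else (h.1 - kk.1, h.2 - kk.2))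
  else if i = p.1.2 then
    (if flip then (h.1 - kk.1, h.2 - kk.2) else ((kk.1 : K), (kk.2 : K)))
  else 0

/-- the coefficient of a binomial expansion of ((𝐳_{p₁} − 𝐳_{p₂})_σ)^h
belonging to 𝐤 ∈ ℕ² -/
def pairCoef (h : Idx K) (flip : Bool) (kk : ℕ × ℕ) : K :=
  (if flip then negOnePow K (h.1 - h.2) else 1) * (-1 : K) ^ (kk.1 + kk.2) *
    gchoose K h.1 kk.1 * gchoose K h.2 kk.2

def flipOf {r : ℕ} (σ : Equiv.Perm (Fin r)) (p : Pairs r) : Bool :=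
  decide (σ.symm p.1.2 < σ.symm p.1.1)

/-- multiplication by Π_{i<j} ((𝐳_i − 𝐳_j)_σ)^{h_{ij}} on an r-variable distribution -/
def permMul {r : ℕ} (σ : Equiv.Perm (Fin r)) (hs : Pairs r → Idx K)
    (c : DistN K M r) : DistN K M r :=
  fun m => ∑ᶠ κ : Pairs r → ℕ × ℕ,
    (∏ p : Pairs r, pairCoef K (hs p) (flipOf σ p) (κ p)) •
      c (fun i => m i + ∑ p : Pairs r, pairShift K p (hs p) (flipOf σ p) (κ p) i)

/-- the Koszul sign ζ' produced by reordering a¹,…,aʳ into a^{σ1},…,a^{σr} -/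
def koszulPerm {r : ℕ} (ps : Fin r → ZMod 2) (σ : Equiv.Perm (Fin r)) : K :=
  ∏ p : Pairs r,
    if σ.symm p.1.2 < σ.symm p.1.1 ∧ ps p.1.1 = 1 ∧ ps p.1.2 = 1 then (-1 : K) else 1

/-- the composition a^{σ1}(𝐳_{σ1})_{m_{σ1}} ∘ ⋯ ∘ a^{σr}(𝐳_{σr})_{m_{σr}} applied to v -/
def compSeq {r : ℕ} (a : Fin r → EDist1 K E) (σ : Equiv.Perm (Fin r))
    (m : Fin r → Idx K) (v : E) : E :=
  (List.ofFn fun j : Fin r => σ j).foldr (fun i acc => a i (m i) acc) v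

/-- the data (c^α, 𝐡_{ij}^k) is a (multiple) OPE of the homogeneous distributions
a¹(𝐳),…,aʳ(𝐳) of parities ps -/
def IsMultOPE {r : ℕ} (a : Fin r → EDist1 K E) (ps : Fin r → ZMod 2)
    (rij : Fin r → Fin r → ℕ) (hs : ∀ i j : Fin r, Fin (rij i j) → Idx K)
    (c : ((p : Pairs r) → Fin (rij p.1.1 p.1.2)) → EDistN K E r) : Prop :=
  (∀ i j k, Kbar K (hs i j k)) ∧
  (∀ α v, InLatN K E (evN K E (c α) v)) ∧
  (∀ σ : Equiv.Perm (Fin r), ∀ v m,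
    koszulPerm K ps σ • compSeq K E a σ m v =
      ∑ α : (p : Pairs r) → Fin (rij p.1.1 p.1.2),
        permMul K E σ (fun p => -(hs p.1.1 p.1.2 (α p))) (evN K E (c α) v) m)

/-- a¹(𝐳),…,aʳ(𝐳) are multiply local -/
def MultiplyLocal {r : ℕ} (a : Fin r → EDist1 K E) (ps : Fin r → ZMod 2) : Prop :=
  ∃ (rij : Fin r → Fin r → ℕ) (hs : ∀ i j : Fin r, Fin (rij i j) → Idx K)
    (c : ((p : Pairs r) → Fin (rij p.1.1 p.1.2)) → EDistN K E r),
      IsMultOPE K E a ps rij hs c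

/-- a set of homogeneous fields (with parities pF) is multiply local -/
def MultLocalSet (F : Set (EDist1 K E)) (pF : EDist1 K E → ZMod 2) : Prop :=
  ∀ (r : ℕ) (f : Fin r → EDist1 K E), (∀ i, f i ∈ F) →
    MultiplyLocal K E f (fun i => pF (f i))

/-- a set of homogeneous fields (with parities pF) is uniformly local -/
def UnifLocalSet (F : Set (EDist1 K E)) (pF : EDist1 K E → ZMod 2) (one : E) : Prop :=
  ∃ (rr : EDist1 K E → EDist1 K E → ℕ)
    (hh : ∀ d e : EDist1 K E, Fin (rr d e) → Idx K),
    ∀ (r : ℕ) (f : Fin r → EDist1 K E), (∀ i, f i ∈ F) →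
      ∃ c, IsMultOPE K E f (fun i => pF (f i)) (fun i j => rr (f i) (f j))
          (fun i j => hh (f i) (f j)) c ∧
        ∀ α, IsPowN K E (evN K E (c α) one)

/-- a ∈ V is homogeneous of parity p w.r.t. the grading (ev, od) -/
def memPar {V : Type*} [AddCommGroup V] [Module K V] (ev od : Submodule K V)
    (a : V) (p : ZMod 2) : Prop :=
  (p = 0 ∧ a ∈ ev) ∨ (p = 1 ∧ a ∈ od)

/-- an endomorphism is homogeneous of parity p w.r.t. the grading (ev, od) -/
def EndPar {V : Type*} [AddCommGroup V] [Module K V] (ev od : Submodule K V)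
    (f : Module.End K V) (p : ZMod 2) : Prop :=
  if p = 0 then (∀ v ∈ ev, f v ∈ ev) ∧ (∀ v ∈ od, f v ∈ od)
  else (∀ v ∈ ev, f v ∈ od) ∧ (∀ v ∈ od, f v ∈ ev)

/-- a distribution is homogeneous of parity p -/
def EDistPar {V : Type*} [AddCommGroup V] [Module K V] (ev od : Submodule K V)
    (a : EDist1 K V) (p : ZMod 2) : Prop :=
  ∀ n, EndPar K ev od (a n) p

end OPEA

namespace OPEA

/-- an OPE-algebra -/
structure OPEAlg (K : Type*) [Field K] [CharZero K]
    (V : Type*) [AddCommGroup V] [Module K V] where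
  ev : Submodule K V
  od : Submodule K V
  compl : IsCompl ev od
  Y : V →ₗ[K] EDist1 K V
  Y_par : ∀ a p, memPar K ev od a p → ∀ (n : Idx K) b q, memPar K ev od b q →
    memPar K ev od (Y a n b) (p + q)
  one : V
  one_ev : one ∈ ev
  T : Module.End K V
  Tb : Module.End K V
  T_ev : EndPar K ev od T 0
  Tb_ev : EndPar K ev od Tb 0
  commTTb : T * Tb = Tb * T
  T_one : T one = 0
  Tb_one : Tb one = 0
  wcre : ∀ a, IsPow1 K V (ev1 K V (Y a) one)
  rid : ∀ a, Y a ((-1 : K), (-1 : K)) one = a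
  tcov : ∀ a, TransCov K V T Tb (Y a)
  loc : ∀ a b pa pb, memPar K ev od a pa → memPar K ev od b pb →
    IsLocal K V pa pb (Y a) (Y b)

/-- a bounded 𝕂̄-fold algebra -/
structure BFold (K : Type*) [Field K] [CharZero K]
    (V : Type*) [AddCommGroup V] [Module K V] where
  ev : Submodule K V
  od : Submodule K V
  compl : IsCompl ev od
  Y : V →ₗ[K] EDist1 K V
  Y_par : ∀ a p, memPar K ev od a p → ∀ (n : Idx K) b q, memPar K ev od b q →
    memPar K ev od (Y a n b) (p + q)
  fields : ∀ a, IsFieldD K V (Y a)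
  bounded : ∀ a (n : Idx K), ¬ Kbar K n → ∀ b, Y a n b = 0

/-- a bounded 𝕂̄-fold module over a bounded 𝕂̄-fold algebra -/
structure BMod (K : Type*) [Field K] [CharZero K]
    (V : Type*) [AddCommGroup V] [Module K V] (A : BFold K V)
    (Mo : Type*) [AddCommGroup Mo] [Module K Mo] where
  evM : Submodule K Mo
  odM : Submodule K Mo
  complM : IsCompl evM odM
  YM : V →ₗ[K] EDist1 K Mo
  YM_par : ∀ a p, memPar K A.ev A.od a p → ∀ n : Idx K, EndPar K evM odM (YM a n) p
  fieldsM : ∀ a, IsFieldD K Mo (YM a)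
  boundedM : ∀ a (n : Idx K), ¬ Kbar K n → ∀ c, YM a n c = 0

variable (K : Type*) [Field K] [CharZero K]
variable (V : Type*) [AddCommGroup V] [Module K V]
variable (Mo : Type*) [AddCommGroup Mo] [Module K Mo]

/-- the operator T₁ : a ↦ a_{(−2,−1)}1 of an OPE-algebra -/
def T1 (A : OPEAlg K V) : Module.End K V where
  toFun := fun a => A.Y a ((-2 : K), (-1 : K)) A.one
  map_add' := by
    intro x y
    simp [map_add, Pi.add_apply, LinearMap.add_apply]
  map_smul' := by
    intro c x
    simp [map_smul, Pi.smul_apply, LinearMap.smul_apply]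

/-- the operator T̄₁ : a ↦ a_{(−1,−2)}1 of an OPE-algebra -/
def T1b (A : OPEAlg K V) : Module.End K V where
  toFun := fun a => A.Y a ((-1 : K), (-2 : K)) A.one
  map_add' := by
    intro x y
    simp [map_add, Pi.add_apply, LinearMap.add_apply]
  map_smul' := by
    intro c x
    simp [map_smul, Pi.smul_apply, LinearMap.smul_apply]

/-- skew-symmetry for the pair (T, T̄) -/
def SkewSym (ev od : Submodule K V) (Yf : V → EDist1 K V)
    (T Tb : Module.End K V) : Prop :=
  ∀ a b pa pb, memPar K ev od a pa → memPar K ev od b pb →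
    ∀ n : Idx K, Kbar K n →
      (Function.support (fun i : ℕ × ℕ =>
        ((i.1.factorial : K)⁻¹ * (i.2.factorial : K)⁻¹ *
            negOnePow K (n.1 + i.1 - (n.2 + i.2))) •
          ((T ^ i.1) * (Tb ^ i.2)) (Yf a (n.1 + i.1, n.2 + i.2) b))).Finite ∧
      koszul K pa pb • Yf b n a =
        ∑ᶠ i : ℕ × ℕ, ((i.1.factorial : K)⁻¹ * (i.2.factorial : K)⁻¹ *
            negOnePow K (n.1 + i.1 - (n.2 + i.2))) •
          ((T ^ i.1) * (Tb ^ i.2)) (Yf a (n.1 + i.1, n.2 + i.2) b)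

/-- (T, T̄) is a translation endomorphism of the module with state-field map YM -/
def TransEnd (YM : V → EDist1 K Mo) (T Tb : Module.End K V) : Prop :=
  (∀ a (n : Idx K), YM (T a) n = (-n.1) • YM a (n.1 - 1, n.2)) ∧
  (∀ a (n : Idx K), YM (Tb a) n = (-n.2) • YM a (n.1, n.2 - 1))

/-- the coefficient at (x-index m, w-index k) of a(𝐱+𝐰) applied to the w-distribution bw -/
def lhsXW (YM : V → EDist1 K Mo) (a : V) (bw : Dist1 K Mo) (m k : Idx K) : Mo :=
  ∑ᶠ i : ℕ × ℕ, ((i.1.factorial : K)⁻¹ * (i.2.factorial : K)⁻¹) •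
    (((dz K (Module.End K Mo))^[i.1] ((dzb K (Module.End K Mo))^[i.2] (YM a))) m)
      (bw (k.1 + i.1, k.2 + i.2))

/-- a and cM are dual in the direct channel -/
def DualDirect (Y : V → EDist1 K V) (YM : V → EDist1 K Mo) (a : V) (cM : Mo) : Prop :=
  ∃ (s : ℕ) (d : Fin s → Idx K → Idx K → (V →ₗ[K] Mo)) (hj : Fin s → Idx K),
    (∀ j, Kbar K (hj j)) ∧
    (∀ j b, InLat2 K Mo (fun kw mx => d j kw mx b)) ∧
    (∀ b (m k : Idx K),
      lhsXW K V Mo YM a (fun k' => YM b k' cM) m k =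
        ∑ j, xwPow K Mo (-(hj j)) (fun kw mx => d j kw mx b) m k) ∧
    (∀ b (m k : Idx K),
      YM (Y a m b) k cM =
        ∑ j, wxPow K Mo (-(hj j)) (fun kw mx => d j kw mx b) m k)

/-- a and b are dual in the exchange channel on the module -/
def DualExch (Y : V → EDist1 K V) (YM : V → EDist1 K Mo) (a b : V) : Prop :=
  ∃ (r : ℕ) (hab : Fin r → Idx K), (∀ i, Kbar K (hab i)) ∧
    ∀ cM : Mo, ∃ (s : ℕ) (hac : Fin s → Idx K)
      (q : Fin r → Fin s → Idx K → Idx K → Mo),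
      (∀ j, Kbar K (hac j)) ∧
      (∀ i j kw mx, q i j kw mx ≠ 0 → IsNegInt K mx.1 ∧ IsNegInt K mx.2) ∧
      (∀ i j mx, InLat1 K Mo (fun kw => q i j kw mx)) ∧
      (∀ m k : Idx K,
        lhsXW K V Mo YM a (fun k' => YM b k' cM) m k =
          ∑ j, xwPow K Mo (-(hac j))
            (fun kw mx => ∑ i, q i j kw (mx.1 - (hab i).1, mx.2 - (hab i).2)) m k) ∧
      (∀ m k : Idx K,
        YM (Y a m b) k cM =
          ∑ j, wxPow K Mo (-(hac j))
            (fun kw mx => ∑ i, q i j kw (mx.1 - (hab i).1, mx.2 - (hab i).2)) m k)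

/-- the module with state-field map YM is dual -/
def IsDualMod (ev od : Submodule K V) (Y : V → EDist1 K V) (YM : V → EDist1 K Mo) : Prop :=
  ∃ (rVV : V → V → ℕ) (hVV : ∀ a b : V, Fin (rVV a b) → Idx K)
    (rVM : V → Mo → ℕ) (hVM : ∀ (a : V) (c : Mo), Fin (rVM a c) → Idx K),
    (∀ a b i, Kbar K (hVV a b i)) ∧ (∀ a c j, Kbar K (hVM a c j)) ∧
    ∀ a b pa pb, memPar K ev od a pa → memPar K ev od b pb → ∀ c : Mo,
      ∃ p : Fin (rVV a b) → Fin (rVM a c) → Fin (rVM b c) → Dist2 K Mo,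
        (∀ i j k, IsPow2 K Mo (p i j k)) ∧
        (∀ m k : Idx K,
          lhsXW K V Mo YM a (fun k' => YM b k' c) m k =
            ∑ i, ∑ j, ∑ kk, tripleXW K Mo (-(hVV a b i)) (-(hVM b c kk))
              (-(hVM a c j)) (p i j kk) m k) ∧
        (∀ m k : Idx K,
          YM (Y a m b) k c =
            ∑ i, ∑ j, ∑ kk, tripleWX K Mo (-(hVV a b i)) (-(hVM b c kk))
              (-(hVM a c j)) (p i j kk) m k)

/-- F_Y is multiply local -/
def MultLocalAlg (A : OPEAlg K V) : Prop :=
  ∀ (r : ℕ) (f : Fin r → V) (pf : Fin r → ZMod 2),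
    (∀ i, memPar K A.ev A.od (f i) (pf i)) →
      MultiplyLocal K V (fun i => A.Y (f i)) pf

/-- F_Y is uniformly local -/
def UnifLocalAlg (A : OPEAlg K V) : Prop :=
  ∃ (rr : V → V → ℕ) (hh : ∀ a b : V, Fin (rr a b) → Idx K),
    ∀ (r : ℕ) (f : Fin r → V) (pf : Fin r → ZMod 2),
      (∀ i, memPar K A.ev A.od (f i) (pf i)) →
        ∃ c, IsMultOPE K V (fun i => A.Y (f i)) pf (fun i j => rr (f i) (f j))
            (fun i j => hh (f i) (f j)) c ∧
          ∀ α, IsPowN K V (evN K V (c α) A.one)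

end OPEA
namespace OPEA

/-- The coefficient of `t ^ z` in the expansion of `(1 - t) ^ x`, for an integer `z`. -/
def binomZ (K : Type*) [Field K] [CharZero K] (x : K) (z : ℤ) : K :=
  if 0 ≤ z then (-1 : K) ^ z.toNat * gchoose K x z.toNat else 0

section OneVariable

variable {K : Type*} [Field K] [CharZero K] {V : Type*} [AddCommGroup V] [Module K V]

lemma gchoose_zero (x : K) : gchoose K x 0 = 1 := by simp [gchoose]

lemma gchoose_succ (x : K) (n : ℕ) :
    ((n : K) + 1) * gchoose K x (n + 1) = (x - n) * gchoose K x n := by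
  have h1 : ((n : K) + 1) ≠ 0 := by exact_mod_cast Nat.succ_ne_zero n
  have h2 : (n.factorial : K) ≠ 0 := by exact_mod_cast n.factorial_ne_zero
  simp only [gchoose, Finset.prod_range_succ, Nat.factorial_succ]
  push_cast
  field_simp

lemma binomZ_natCast (x : K) (n : ℕ) : binomZ K x n = (-1 : K) ^ n * gchoose K x n := by
  simp [binomZ]

lemma binomZ_of_neg (x : K) {z : ℤ} (hz : z < 0) : binomZ K x z = 0 := by
  simp [binomZ, not_le.mpr hz]

lemma binomZ_zero (x : K) : binomZ K x 0 = 1 := by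
  simp [binomZ, gchoose_zero]

lemma binomZ_succ (x : K) (z : ℤ) :
    ((z : K) + 1) * binomZ K x (z + 1) = ((z : K) - x) * binomZ K x z := by
  rcases lt_trichotomy z (-1) with hz | rfl | hz
  · rw [binomZ_of_neg x (by omega), binomZ_of_neg x (by omega)]
    simp
  · rw [binomZ_of_neg x (by omega : (-1 : ℤ) < 0)]
    simp
  · obtain ⟨n, rfl⟩ := Int.eq_ofNat_of_zero_le (by omega : 0 ≤ z)
    have h := gchoose_succ x n
    have h' : ((n : ℤ) + 1) = ((n + 1 : ℕ) : ℤ) := by push_cast; rfl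
    rw [h', binomZ_natCast, binomZ_natCast, pow_succ]
    push_cast
    linear_combination (-(-1 : K) ^ n) * h

/-- For finitely supported `e`, the coefficient at index `n` of `(1 - t) ^ b` times
the Laurent polynomial `∑ j, e j * t ^ (-j)` (in the two variables `t`, `t̄`). -/
def binomEval (b : Idx K) (n : ℤ × ℤ) : ((ℤ × ℤ) →₀ V) →ₗ[K] V :=
  Finsupp.lsum K fun j =>
    (binomZ K b.1 (j.1 - n.1) * binomZ K b.2 (j.2 - n.2)) • LinearMap.id

lemma binomEval_single (b : Idx K) (n j : ℤ × ℤ) (v : V) :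
    binomEval b n (Finsupp.single j v) =
      (binomZ K b.1 (j.1 - n.1) * binomZ K b.2 (j.2 - n.2)) • v := by
  simp [binomEval]

/-- The operator on Laurent polynomials in `t`, `t̄` which, after multiplication by
`(1 - t) ^ b`, becomes `(1 - t) ∂_t` conjugated by `t ^ B` and shifted by a scalar. -/
def eulerStep (B : ℤ) (b l : K) : ((ℤ × ℤ) →₀ V) →ₗ[K] ((ℤ × ℤ) →₀ V) :=
  Finsupp.lsum K fun j =>
    ((j.1 : K) - B - b - l) • Finsupp.lsingle j -
      ((j.1 : K) - B) • Finsupp.lsingle (j.1 + 1, j.2)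

omit [CharZero K] in
lemma eulerStep_apply (B : ℤ) (b l : K) (e : (ℤ × ℤ) →₀ V) (j : ℤ × ℤ) :
    eulerStep B b l e j =
      ((j.1 : K) - B - b - l) • e j - ((j.1 : K) - 1 - B) • e (j.1 - 1, j.2) := by
  induction e using Finsupp.induction_linear with
  | zero => simp
  | add f g hf hg => rw [map_add, Finsupp.add_apply, hf, hg]; simp only [Finsupp.add_apply]; module
  | single a v =>
    obtain ⟨a1, a2⟩ := a
    obtain ⟨j1, j2⟩ := j
    simp only [eulerStep, Finsupp.lsum_single, LinearMap.sub_apply, LinearMap.smul_apply,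
      Finsupp.lsingle_apply, Finsupp.sub_apply, Finsupp.smul_apply]
    congr 1
    · by_cases h : (a1, a2) = (j1, j2)
      · cases h; simp
      · simp [Finsupp.single_eq_of_ne' h]
    · by_cases h : (a1, a2) = (j1 - 1, j2)
      · cases h
        simp
      · have h' : (a1 + 1, a2) ≠ (j1, j2) := by
          intro h'
          apply h
          simp only [Prod.mk.injEq] at h' ⊢
          omega
        simp [Finsupp.single_eq_of_ne' h, Finsupp.single_eq_of_ne' h']

lemma binomEval_eulerStep (B : ℤ) (b : Idx K) (l : K) (e : (ℤ × ℤ) →₀ V) (n : ℤ × ℤ) :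
    binomEval b n (eulerStep B b.1 l e) =
      ((n.1 : K) - B - l) • binomEval b n e -
        ((n.1 : K) - 1 - B) • binomEval b (n.1 - 1, n.2) e := by
  induction e using Finsupp.induction_linear with
  | zero => simp
  | add f g hf hg => simp only [map_add, hf, hg]; module
  | single a v =>
    have h := binomZ_succ b.1 (a.1 - n.1)
    simp only [eulerStep, Finsupp.lsum_single, LinearMap.sub_apply, LinearMap.smul_apply,
      Finsupp.lsingle_apply, map_sub, map_smul, binomEval_single, smul_smul, ← sub_smul]
    congr 1
    have e1 : a.1 + 1 - n.1 = a.1 - n.1 + 1 := by ring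
    have e2 : a.1 - (n.1 - 1) = a.1 - n.1 + 1 := by ring
    rw [e1, e2]
    push_cast at h
    linear_combination (binomZ K b.2 (a.2 - n.2)) * -h

lemma eq_zero_of_binomEval_eq_zero (b : Idx K) (e : (ℤ × ℤ) →₀ V)
    (h : ∀ n, binomEval b n e = 0) : e = 0 := by
  by_contra hne
  obtain ⟨j, hj, hmax⟩ := e.support.exists_max_image (fun j => j.1 + j.2)
    (Finsupp.support_nonempty_iff.mpr hne)
  have h1 := h j
  rw [binomEval, Finsupp.lsum_apply, Finsupp.sum, Finset.sum_eq_single j] at h1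
  · simp [binomZ_zero] at h1
    exact (Finsupp.mem_support_iff.mp hj) h1
  · intro i hi hij
    have hle := hmax i hi
    have : i.1 - j.1 < 0 ∨ i.2 - j.2 < 0 := by
      by_contra hcon
      apply hij
      ext <;> omega
    rcases this with hlt | hlt <;> simp [binomZ_of_neg _ hlt]
  · exact fun hcon => absurd hj hcon

variable {ι : Type*} [Fintype ι]

/-- `∑ k, (1 - t) ^ (β k) * e k = 0`, with all the supports bounded above by `B`. -/
structure BinomRel (B : ℤ) (β : ι → Idx K) (e : ι → (ℤ × ℤ) →₀ V) : Prop where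
  sum_eq_zero : ∀ n, ∑ k, binomEval (β k) n (e k) = 0
  bound : ∀ k j, e k j ≠ 0 → j.1 ≤ B ∧ j.2 ≤ B

lemma BinomRel.eulerStep {B : ℤ} {β : ι → Idx K} {e : ι → (ℤ × ℤ) →₀ V}
    (h : BinomRel B β e) (l : K) :
    BinomRel B β (fun k => eulerStep B (β k).1 l (e k)) where
  sum_eq_zero n := by
    simp only [binomEval_eulerStep, Finset.sum_sub_distrib, ← Finset.smul_sum, h.sum_eq_zero]
    simp
  bound k j hj := by
    rw [eulerStep_apply] at hj
    by_cases h1 : e k j = 0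
    · rw [h1, smul_zero, zero_sub, neg_ne_zero] at hj
      have h2 := h.bound k _ (right_ne_zero_of_smul hj)
      have h3 : j.1 - 1 ≠ B := by
        rintro rfl
        apply hj
        push_cast
        simp
      simp only at h2
      omega
    · exact h.bound k j h1

lemma BinomRel.swap {B : ℤ} {β : ι → Idx K} {e : ι → (ℤ × ℤ) →₀ V} (h : BinomRel B β e) :
    BinomRel B (fun k => (β k).swap)
      (fun k => Finsupp.domLCongr (R := K) (Equiv.prodComm ℤ ℤ) (e k)) where
  sum_eq_zero n := by
    rw [← h.sum_eq_zero n.swap]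
    refine Finset.sum_congr rfl fun k _ => ?_
    induction e k using Finsupp.induction_linear with
    | zero => simp
    | add f g hf hg => simp only [map_add, hf, hg]
    | single a v =>
      simp [binomEval_single, mul_comm]
  bound k j hj := by
    have := h.bound k j.swap (by simpa using hj)
    exact ⟨this.2, this.1⟩

/-- The entry `m` of a relation can be made zero without killing the entry `k₀`, when the
first components of the exponents at `m` and `k₀` do not differ by an integer. -/
lemma BinomRel.exists_eliminate {B : ℤ} {β : ι → Idx K} {e : ι → (ℤ × ℤ) →₀ V}
    (h : BinomRel B β e) {k₀ m : ι} (hm : ¬ IsInt K ((β k₀).1 - (β m).1)) (h₀ : e k₀ ≠ 0) :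
    ∃ e' : ι → (ℤ × ℤ) →₀ V, BinomRel B β e' ∧ e' k₀ ≠ 0 ∧ e' m = 0 ∧
      ∀ k, e k = 0 → e' k = 0 := by
  obtain ⟨N, hN⟩ : ∃ N : ℕ, ∀ j, e m j ≠ 0 → B < j.1 + N := by
    obtain ⟨A, hA⟩ := ((e m).support.image Prod.fst).bddBelow
    refine ⟨(B - A + 1).toNat, fun j hj => ?_⟩
    have : A ≤ j.1 := hA (by
      simp only [Finset.coe_image, Set.mem_image, Finset.mem_coe, Finsupp.mem_support_iff]
      exact ⟨j, hj, rfl⟩)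
    omega
  induction N generalizing e with
  | zero =>
    refine ⟨e, h, h₀, ?_, fun _ hk => hk⟩
    ext j
    by_contra hj
    have h1 := hN j hj
    have h2 := h.bound m j hj
    push_cast at h1
    omega
  | succ N ih =>
    have hzero : ∀ k, e k = 0 → OPEA.eulerStep B (β k).1 (-(N : K) - (β m).1) (e k) = 0 :=
      fun k hk => by rw [hk, map_zero]
    have hne : OPEA.eulerStep B (β k₀).1 (-(N : K) - (β m).1) (e k₀) ≠ 0 := by
      obtain ⟨j, hj, hmin⟩ := (e k₀).support.exists_min_image Prod.fst
        (Finsupp.support_nonempty_iff.mpr h₀)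
      intro hcon
      have hcon' := DFunLike.congr_fun hcon j
      rw [eulerStep_apply] at hcon'
      have hprev : e k₀ (j.1 - 1, j.2) = 0 := by
        by_contra hne
        have := hmin _ (Finsupp.mem_support_iff.mpr hne)
        simp only at this
        omega
      rw [hprev, smul_zero, sub_zero, Finsupp.zero_apply, smul_eq_zero] at hcon'
      rcases hcon' with hc | hc
      · refine hm ⟨j.1 - B + N, ?_⟩
        push_cast
        linear_combination hc
      · exact Finsupp.mem_support_iff.mp hj hc
    have hbd : ∀ j, OPEA.eulerStep B (β m).1 (-(N : K) - (β m).1) (e m) j ≠ 0 →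
        B < j.1 + N := by
      intro j hj
      rw [eulerStep_apply] at hj
      by_contra hlt
      have hprev : e m (j.1 - 1, j.2) = 0 := by
        by_contra hne
        have := hN _ hne
        push_cast at this
        omega
      rw [hprev, smul_zero, sub_zero] at hj
      have h1 := hN j (right_ne_zero_of_smul hj)
      push_cast at h1
      apply left_ne_zero_of_smul hj
      have h2 : j.1 = B - N := by omega
      rw [h2]
      push_cast
      ring
    obtain ⟨e', h1, h2, h3, h4⟩ := ih (h.eulerStep (-(N : K) - (β m).1)) hne hbd
    exact ⟨e', h1, h2, h3, fun k hk => h4 k (hzero k hk)⟩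

/-- The functions `(1 - t) ^ (β k)` with exponents pairwise distinct modulo `ℤ²` are linearly
independent over Laurent polynomials. -/
theorem eq_zero_of_sum_binomEval_eq_zero {β : ι → Idx K}
    (hβ : ∀ k l, k ≠ l → ¬ IsIntPair K (β k - β l)) {e : ι → (ℤ × ℤ) →₀ V}
    (h : ∀ n, ∑ k, binomEval (β k) n (e k) = 0) (k₀ : ι) : e k₀ = 0 := by
  by_contra h₀
  obtain ⟨B, hB⟩ : ∃ B : ℤ, BinomRel B β e := by
    obtain ⟨B, hB⟩ := (Finset.univ.biUnion fun k =>
      (e k).support.image fun j => max j.1 j.2).bddAbove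
    refine ⟨B, h, fun k j hj => max_le_iff.mp (hB ?_)⟩
    simp only [Finset.coe_biUnion, Set.mem_iUnion, Finset.coe_image, Set.mem_image,
      Finset.mem_coe, Finsupp.mem_support_iff]
    exact ⟨k, Finset.mem_univ k, j, hj, rfl⟩
  have key : ∀ T : Finset ι, ∃ e' : ι → (ℤ × ℤ) →₀ V,
      BinomRel B β e' ∧ e' k₀ ≠ 0 ∧ ∀ m ∈ T, m ≠ k₀ → e' m = 0 := by
    intro T
    induction T using Finset.induction_on with
    | empty => exact ⟨e, hB, h₀, by simp⟩
    | insert m T _ ih =>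
      obtain ⟨e', h1, h2, h3⟩ := ih
      by_cases hm : m = k₀
      · refine ⟨e', h1, h2, fun l hl hlk => ?_⟩
        rcases Finset.mem_insert.mp hl with rfl | hl
        · exact absurd hm hlk
        · exact h3 l hl hlk
      · obtain ⟨e'', g1, g2, g3, g4⟩ : ∃ e'' : ι → (ℤ × ℤ) →₀ V, BinomRel B β e'' ∧
            e'' k₀ ≠ 0 ∧ e'' m = 0 ∧ ∀ k, e' k = 0 → e'' k = 0 := by
          rcases not_and_or.mp (hβ k₀ m (Ne.symm hm)) with hint | hint
          · exact h1.exists_eliminate hint h2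
          · obtain ⟨e'', g1, g2, g3, g4⟩ := h1.swap.exists_eliminate (k₀ := k₀) (m := m) hint
              ((LinearEquiv.map_ne_zero_iff _).mpr h2)
            refine ⟨_, g1.swap, ?_, ?_, ?_⟩
            · exact (LinearEquiv.map_ne_zero_iff _).mpr g2
            · simp [g3]
            · intro k hk
              simp [g4 k (by simp [hk])]
        refine ⟨e'', g1, g2, fun l hl hlk => ?_⟩
        rcases Finset.mem_insert.mp hl with rfl | hl
        · exact g3
        · exact g4 l (h3 l hl hlk)
  obtain ⟨e', h1, h2, h3⟩ := key Finset.univ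
  refine h2 (eq_zero_of_binomEval_eq_zero (β k₀) (e' k₀) fun n => ?_)
  rw [← h1.sum_eq_zero n]
  symm
  apply Finset.sum_eq_single k₀
  · intro m _ hm
    rw [h3 m (Finset.mem_univ m) hm, map_zero]
  · exact fun hk => absurd (Finset.mem_univ _) hk

end OneVariable

lemma finsum_comp_of_injective {A B M : Type*} [AddCommMonoid M] {φ : A → B}
    (hφ : Function.Injective φ) {g : B → M} (hg : ∀ b, g b ≠ 0 → b ∈ Set.range φ) :
    ∑ᶠ a, g (φ a) = ∑ᶠ b, g b := by
  rw [← finsum_mem_range hφ]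
  refine finsum_congr fun b => ?_
  by_cases hb : b ∈ Set.range φ
  · simp [hb]
  · simp [hb, not_imp_comm.mp (hg b) hb]

def castPair (κ : ℕ × ℕ) : ℤ × ℤ := (κ.1, κ.2)

lemma castPair_injective : Function.Injective castPair := by
  intro a b h
  simpa [castPair, Prod.ext_iff] using h

section Elimination

variable {K : Type*} [Field K] [CharZero K] {V : Type*} [AddCommGroup V] [Module K V]

lemma pairCoef_false (b : Idx K) (κ : ℕ × ℕ) :
    pairCoef K b false κ = binomZ K b.1 κ.1 * binomZ K b.2 κ.2 := by
  simp only [pairCoef, binomZ_natCast, pow_add]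
  simp
  ring

/-- A version of `eq_zero_of_sum_binomEval_eq_zero` for functions of finite support. -/
lemma eq_zero_of_sum_finsum_pairCoef {ι : Type*} [Fintype ι] {β : ι → Idx K}
    (hβ : ∀ k l, k ≠ l → ¬ IsIntPair K (β k - β l)) {F : ι → ℤ × ℤ → V}
    (hF : ∀ k, (Function.support (F k)).Finite)
    (h : ∀ n, ∑ k, ∑ᶠ κ, pairCoef K (β k) false κ • F k (n + castPair κ) = 0)
    (k : ι) (n : ℤ × ℤ) : F k n = 0 := by
  have key := eq_zero_of_sum_binomEval_eq_zero hβ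
    (e := fun k => Finsupp.ofSupportFinite (F k) (hF k)) (fun n => ?_) k
  · exact DFunLike.congr_fun key n
  rw [← h n]
  refine Finset.sum_congr rfl fun k _ => ?_
  rw [binomEval, Finsupp.lsum_apply, Finsupp.sum,
    ← finsum_eq_sum_of_support_subset, ← finsum_comp_of_injective
      (φ := fun κ => n + castPair κ) ((add_right_injective n).comp castPair_injective)]
  · refine finsum_congr fun κ => ?_
    simp [pairCoef_false, Finsupp.ofSupportFinite_coe, castPair]
  · intro j hj
    have h1 : 0 ≤ j.1 - n.1 := by
      by_contra hlt
      simp [binomZ_of_neg _ (not_le.mp hlt)] at hj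
    have h2 : 0 ≤ j.2 - n.2 := by
      by_contra hlt
      simp [binomZ_of_neg _ (not_le.mp hlt)] at hj
    refine ⟨((j.1 - n.1).toNat, (j.2 - n.2).toNat), ?_⟩
    ext <;> simp [castPair] <;> omega
  · intro j hj
    simp only [Finset.mem_coe, Finsupp.mem_support_iff]
    intro h0
    simp [h0] at hj

variable {ι : Type*} [Fintype ι] [DecidableEq ι] {G : Type*} [AddCommGroup G]
  {s : ι → Type*} [∀ p, Fintype (s p)]

def shiftBy (δ : ι → ℤ × ℤ →+ G) (κ : ι → ℕ × ℕ) : G :=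
  ∑ p, δ p (castPair (κ p))

/-- The coefficient of the multi-index `κ` in the expansion of the product of the binomials
indexed by `p ∈ S`. -/
def stageWeight (β : ∀ p, s p → Idx K) (S : Finset ι) (α : ∀ p, s p) (κ : ι → ℕ × ℕ) : K :=
  ∏ p, if p ∈ S then pairCoef K (β p (α p)) false (κ p) else if κ p = 0 then 1 else 0

def stageTerm (δ : ι → ℤ × ℤ →+ G) (β : ∀ p, s p → Idx K) (d : (∀ p, s p) → G → V)
    (S : Finset ι) (α : ∀ p, s p) (m : G) : V :=
  ∑ᶠ κ : ι → ℕ × ℕ, stageWeight β S α κ • d α (m + shiftBy δ κ)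

/-- The pairs of a shift in the direction `j` and an expansion multi-index in the directions
of `T` which reach the support of `u` from `m`. -/
def reachSet (δ : ι → ℤ × ℤ →+ G) (u : G → V) (j : ι) (T : Finset ι) (m : G) :
    Set ((ℤ × ℤ) × (ι → ℕ × ℕ)) :=
  {x | (∀ p ∉ T, x.2 p = 0) ∧ u (m + δ j x.1 + shiftBy δ x.2) ≠ 0}

omit [CharZero K] [∀ p, Fintype (s p)] in
lemma stageWeight_eq_zero (β : ∀ p, s p → Idx K) {S : Finset ι} (α : ∀ p, s p)
    {κ : ι → ℕ × ℕ} {p : ι} (hp : p ∉ S) (hκ : κ p ≠ 0) : stageWeight β S α κ = 0 :=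
  Finset.prod_eq_zero (Finset.mem_univ p) (by simp [hp, hκ])

lemma shiftBy_eq_add (δ : ι → ℤ × ℤ →+ G) (κ : ι → ℕ × ℕ) (j : ι) :
    shiftBy δ κ = δ j (castPair (κ j)) + shiftBy δ (Function.update κ j 0) := by
  have h0 : castPair 0 = 0 := rfl
  simp only [shiftBy]
  rw [← Finset.add_sum_erase _ _ (Finset.mem_univ j),
    ← Finset.add_sum_erase (a := j) Finset.univ
      (fun p => δ p (castPair (Function.update κ j 0 p))) (Finset.mem_univ j),
    Function.update_self, h0, map_zero, zero_add]
  congr 1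
  refine Finset.sum_congr rfl fun p hp => ?_
  rw [Function.update_of_ne (Finset.ne_of_mem_erase hp)]

omit [CharZero K] [∀ p, Fintype (s p)] in
lemma stageWeight_eq_mul (β : ∀ p, s p → Idx K) {S : Finset ι} (α : ∀ p, s p)
    (κ : ι → ℕ × ℕ) {j : ι} (hj : j ∈ S) :
    stageWeight β S α κ = pairCoef K (β j (α j)) false (κ j) *
      stageWeight β (S.erase j) α (Function.update κ j 0) := by
  simp only [stageWeight]
  rw [← Finset.mul_prod_erase _ _ (Finset.mem_univ j), ← Finset.mul_prod_erase (a := j)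
    Finset.univ (fun p => if p ∈ S.erase j then _ else _) (Finset.mem_univ j)]
  simp only [hj, if_true, Finset.notMem_erase, if_false, Function.update_self, one_mul]
  congr 1
  refine Finset.prod_congr rfl fun p hp => ?_
  have hpj := Finset.ne_of_mem_erase hp
  simp [Finset.mem_erase, hpj]

omit [CharZero K] [∀ p, Fintype (s p)] in
lemma stageTerm_support_finite {δ : ι → ℤ × ℤ →+ G} (β : ∀ p, s p → Idx K)
    {d : (∀ p, s p) → G → V} {T : Finset ι} {α : ∀ p, s p} {j : ι} {m : G}
    (hfin : (reachSet δ (d α) j T m).Finite) :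
    (Function.support fun z => stageTerm δ β d T α (m + δ j z)).Finite := by
  refine (hfin.image Prod.fst).subset fun z hz => ?_
  obtain ⟨κ, hκ⟩ : ∃ κ, stageWeight β T α κ • d α (m + δ j z + shiftBy δ κ) ≠ 0 := by
    by_contra! hall
    exact hz (finsum_eq_zero_of_forall_eq_zero hall)
  refine ⟨(z, κ), ⟨fun p hp => ?_, right_ne_zero_of_smul hκ⟩, rfl⟩
  by_contra hne
  exact left_ne_zero_of_smul hκ (stageWeight_eq_zero β α hp hne)

omit [CharZero K] [∀ p, Fintype (s p)] in
lemma stageTerm_eq_finsum {δ : ι → ℤ × ℤ →+ G} (β : ∀ p, s p → Idx K)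
    {d : (∀ p, s p) → G → V} {S : Finset ι} {α : ∀ p, s p} {j : ι} (hj : j ∈ S) {m : G}
    (hfin : (reachSet δ (d α) j (S.erase j) m).Finite) :
    stageTerm δ β d S α m = ∑ᶠ κ : ℕ × ℕ, pairCoef K (β j (α j)) false κ •
      stageTerm δ β d (S.erase j) α (m + δ j (castPair κ)) := by
  set X : (ℕ × ℕ) × (ι → ℕ × ℕ) → V := fun x => pairCoef K (β j (α j)) false x.1 •
    stageWeight β (S.erase j) α x.2 • d α (m + δ j (castPair x.1) + shiftBy δ x.2) with hX
  have hzero : ∀ x, X x ≠ 0 → ∀ p ∉ S.erase j, x.2 p = 0 := by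
    intro x hx p hp
    by_contra hne
    exact left_ne_zero_of_smul (right_ne_zero_of_smul hx) (stageWeight_eq_zero β α hp hne)
  have hXfin : (Function.support X).Finite := by
    refine Set.Finite.of_finite_image (f := Prod.map castPair id) (hfin.subset ?_)
      (castPair_injective.prodMap Function.injective_id).injOn
    rintro _ ⟨x, hx, rfl⟩
    exact ⟨hzero x hx, right_ne_zero_of_smul (right_ne_zero_of_smul hx)⟩
  have hφ : Function.Injective
      fun κ : ι → ℕ × ℕ => ((κ j, Function.update κ j 0) : (ℕ × ℕ) × (ι → ℕ × ℕ)) := by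
    intro κ κ' h
    simp only [Prod.mk.injEq] at h
    funext p
    by_cases hp : p = j
    · rw [hp, h.1]
    · simpa [hp] using congrFun h.2 p
  have h1 : stageTerm δ β d S α m = ∑ᶠ x, X x := by
    rw [← finsum_comp_of_injective hφ]
    · refine finsum_congr fun κ => ?_
      simp only [hX]
      rw [shiftBy_eq_add δ κ j, stageWeight_eq_mul β α κ hj, mul_smul, ← add_assoc]
    · intro x hx
      refine ⟨Function.update x.2 j x.1, Prod.ext (by simp) ?_⟩
      simp only [Function.update_idem]
      rw [← hzero x hx j (Finset.notMem_erase j S), Function.update_eq_self]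
  rw [h1, finsum_curry X hXfin]
  refine finsum_congr fun κ => ?_
  rw [stageTerm, smul_finsum]

lemma sum_stageTerm_erase {δ : ι → ℤ × ℤ →+ G} {β : ∀ p, s p → Idx K}
    (hβ : ∀ p k l, k ≠ l → ¬ IsIntPair K (β p k - β p l))
    {d : (∀ p, s p) → G → V} {S : Finset ι} {j : ι} (hj : j ∈ S)
    (hfin : ∀ α m, (reachSet δ (d α) j (S.erase j) m).Finite)
    (h : ∀ (γ : ∀ p, s p) m,
      (∑ α, if ∀ p ∉ S, α p = γ p then stageTerm δ β d S α m else 0) = 0)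
    (γ : ∀ p, s p) (m : G) :
    (∑ α, if ∀ p ∉ S.erase j, α p = γ p then stageTerm δ β d (S.erase j) α m else 0) = 0 := by
  have hiff : ∀ (α : ∀ p, s p) (k : s j),
      (∀ p ∉ S.erase j, α p = Function.update γ j k p) ↔
        (∀ p ∉ S, α p = γ p) ∧ α j = k := by
    intro α k
    constructor
    · intro hα
      refine ⟨fun p hp => ?_, ?_⟩
      · rw [hα p (fun hp' => hp (Finset.mem_of_mem_erase hp')),
          Function.update_of_ne (by rintro rfl; exact hp hj)]
      · rw [hα j (Finset.notMem_erase j S), Function.update_self]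
    · rintro ⟨hα, rfl⟩ p hp
      by_cases hpj : p = j
      · subst hpj; simp
      · rw [Function.update_of_ne hpj, hα p fun hp' => hp (Finset.mem_erase.mpr ⟨hpj, hp'⟩)]
  have hsupp : ∀ (P : Prop) [Decidable P] (α : ∀ p, s p), (Function.support fun z =>
      if P then stageTerm δ β d (S.erase j) α (m + δ j z) else 0).Finite := by
    intro P _ α
    refine (stageTerm_support_finite β (hfin α m)).subset fun z hz => ?_
    by_cases hP : P
    · simpa [hP] using hz
    · simp [hP] at hz
  have key := eq_zero_of_sum_finsum_pairCoef (hβ j)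
    (F := fun k z => ∑ α, if ∀ p ∉ S.erase j, α p = Function.update γ j k p then
      stageTerm δ β d (S.erase j) α (m + δ j z) else 0) (fun k => ?_) (fun n => ?_) (γ j) 0
  · simpa using key
  · refine (Set.finite_iUnion fun α =>
      hsupp (∀ p ∉ S.erase j, α p = Function.update γ j k p) α).subset fun z hz => ?_
    obtain ⟨α, -, hα⟩ := Finset.exists_ne_zero_of_sum_ne_zero hz
    exact Set.mem_iUnion.mpr ⟨α, hα⟩
  · refine Eq.trans ?_ (h γ (m + δ j n))
    have hsum : ∀ k, (∑ᶠ κ, pairCoef K (β j k) false κ • ∑ α,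
        if ∀ p ∉ S.erase j, α p = Function.update γ j k p then
          stageTerm δ β d (S.erase j) α (m + δ j (n + castPair κ)) else 0) =
        ∑ α, ∑ᶠ κ, pairCoef K (β j k) false κ •
          if ∀ p ∉ S.erase j, α p = Function.update γ j k p then
            stageTerm δ β d (S.erase j) α (m + δ j (n + castPair κ)) else 0 := by
      intro k
      simp only [Finset.smul_sum]
      refine finsum_sum_comm _ _ fun α _ => ?_
      have hinj : Function.Injective fun κ => n + castPair κ :=
        (add_right_injective n).comp castPair_injective
      refine Set.Finite.subset ((hsupp (∀ p ∉ S.erase j, α p = Function.update γ j k p)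
        α).preimage hinj.injOn) fun κ hκ => ?_
      exact right_ne_zero_of_smul (Function.mem_support.mp hκ)
    refine (Finset.sum_congr rfl fun k _ => hsum k).trans ?_
    rw [Finset.sum_comm]
    refine Finset.sum_congr rfl fun α _ => ?_
    simp only [hiff]
    by_cases hα : ∀ p ∉ S, α p = γ p
    · rw [Finset.sum_eq_single (α j), if_pos hα, stageTerm_eq_finsum β hj (hfin α _)]
      · refine finsum_congr fun κ => ?_
        rw [if_pos ⟨hα, rfl⟩, map_add, add_assoc]
      · intro k _ hk
        simp [Ne.symm hk]
      · exact fun hk => absurd (Finset.mem_univ _) hk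
    · simp [hα]

/-- If the coefficient distributions `d α` have suitably finite supports, a relation
`∑ α, (∏ p, binomial with exponent β p (α p)) * d α = 0` with exponents reduced for each `p`
is trivial. -/
theorem eq_zero_of_sum_stageTerm_univ {δ : ι → ℤ × ℤ →+ G} {β : ∀ p, s p → Idx K}
    (hβ : ∀ p k l, k ≠ l → ¬ IsIntPair K (β p k - β p l)) {d : (∀ p, s p) → G → V}
    (hfin : ∀ S : Finset ι, S.Nonempty → ∃ j ∈ S, ∀ α m,
      (reachSet δ (d α) j (S.erase j) m).Finite)
    (h : ∀ m, ∑ α, stageTerm δ β d Finset.univ α m = 0) (α : ∀ p, s p) (m : G) :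
    d α m = 0 := by
  have key : ∀ S : Finset ι, (∀ (γ : ∀ p, s p) m,
      (∑ α, if ∀ p ∉ S, α p = γ p then stageTerm δ β d S α m else 0) = 0) →
      ∀ (γ : ∀ p, s p) m,
        (∑ α, if ∀ p ∉ (∅ : Finset ι), α p = γ p then stageTerm δ β d ∅ α m else 0) = 0 := by
    intro S
    induction S using Finset.strongInduction with
    | H S ih =>
      intro hS
      rcases S.eq_empty_or_nonempty with rfl | hne
      · exact hS
      · obtain ⟨j, hj, hfinj⟩ := hfin S hne
        exact ih _ (Finset.erase_ssubset hj) (sum_stageTerm_erase hβ hj hfinj hS)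
  have h0 := key Finset.univ (fun γ m => by simpa using h m) α m
  rw [Finset.sum_eq_single α] at h0
  · rw [if_pos (fun _ _ => rfl), stageTerm, finsum_eq_single _ 0] at h0
    · have hs : shiftBy δ (0 : ι → ℕ × ℕ) = 0 :=
        Finset.sum_eq_zero fun p _ => map_zero (δ p)
      simpa [stageWeight, hs] using h0
    · intro κ hκ
      obtain ⟨p, hp⟩ := Function.ne_iff.mp hκ
      rw [stageWeight_eq_zero β α (Finset.notMem_empty p) hp, zero_smul]
  · intro γ _ hγ
    exact if_neg fun hcon => hγ (funext fun p => hcon p (Finset.notMem_empty p))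
  · exact fun hk => absurd (Finset.mem_univ _) hk

end Elimination
section Pairs

variable {K : Type*} [Field K] [CharZero K] {V : Type*} [AddCommGroup V] [Module K V] {r : ℕ}

/-- The index shift produced by a monomial of an expansion of a power of `𝐳_{p₁} − 𝐳_{p₂}`,
up to the leading exponent. -/
def pairDelta (K : Type*) [Field K] (p : Pairs r) : ℤ × ℤ →+ (Fin r → Idx K) :=
  (AddMonoidHom.single (fun _ : Fin r => Idx K) p.1.2 -
    AddMonoidHom.single (fun _ : Fin r => Idx K) p.1.1).comp
      ((Int.castAddHom K).prodMap (Int.castAddHom K))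

omit [CharZero K] in
lemma pairDelta_apply (p : Pairs r) (z : ℤ × ℤ) (i : Fin r) :
    pairDelta K p z i = (Pi.single p.1.2 ((z.1 : K), (z.2 : K)) : Fin r → Idx K) i -
      (Pi.single p.1.1 ((z.1 : K), (z.2 : K)) : Fin r → Idx K) i := rfl

lemma pairDelta_injective (p : Pairs r) : Function.Injective (pairDelta K p) := by
  intro z z' h
  have h2 := congrFun h p.1.2
  simpa [pairDelta_apply, p.2.ne', Prod.ext_iff] using h2

def pairOffset (hs : Pairs r → Idx K) : Fin r → Idx K :=
  ∑ p, Pi.single p.1.1 (hs p)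

omit [CharZero K] in
lemma pairShift_false (p : Pairs r) (h : Idx K) (κ : ℕ × ℕ) (i : Fin r) :
    pairShift K p h false κ i =
      (Pi.single p.1.1 h : Fin r → Idx K) i + pairDelta K p (castPair κ) i := by
  have hne := p.2.ne
  rw [pairDelta_apply, pairShift]
  by_cases h1 : i = p.1.1
  · subst h1
    simp [hne, castPair, Prod.ext_iff, sub_eq_add_neg]
  · by_cases h2 : i = p.1.2
    · subst h2
      simp [hne.symm, castPair]
    · simp [h1, h2]

omit [CharZero K] in
lemma add_sum_pairShift_false (hs : Pairs r → Idx K) (κ : Pairs r → ℕ × ℕ) (m : Fin r → Idx K) :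
    (fun i => m i + ∑ p, pairShift K p (hs p) false (κ p) i) =
      m + pairOffset hs + shiftBy (pairDelta K) κ := by
  funext i
  simp only [pairShift_false, Finset.sum_add_distrib, pairOffset, shiftBy, Pi.add_apply,
    Finset.sum_apply, add_assoc]

lemma flipOf_one (p : Pairs r) : flipOf 1 p = false := by
  exact decide_eq_false (not_lt.mpr p.2.le)

omit [CharZero K] in
lemma permMul_one_apply (hs : Pairs r → Idx K) (u : DistN K V r) (m : Fin r → Idx K) :
    permMul K V 1 hs u m = ∑ᶠ κ : Pairs r → ℕ × ℕ, (∏ p, pairCoef K (hs p) false (κ p)) •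
      u (m + pairOffset hs + shiftBy (pairDelta K) κ) := by
  simp only [permMul, flipOf_one, add_sum_pairShift_false]

omit [CharZero K] in
lemma permMul_one_eq_stageTerm {s : Pairs r → Type*} [∀ p, Fintype (s p)]
    (β : ∀ p, s p → Idx K) (d : (∀ p, s p) → DistN K V r) (α : ∀ p, s p) (m : Fin r → Idx K) :
    permMul K V 1 (fun p => β p (α p)) (d α) m =
      stageTerm (pairDelta K) β (fun α n => d α (n + pairOffset fun p => β p (α p)))
        Finset.univ α m := by
  rw [permMul_one_apply, stageTerm]
  refine finsum_congr fun κ => ?_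
  simp only [stageWeight, Finset.mem_univ, if_true]
  rw [add_right_comm]

/-- The linear form `n ↦ ∑ i, w i (n i + n̄ i)` on multi-indices. -/
def levelHom (w : Fin r → K) : (Fin r → Idx K) →+ K where
  toFun n := ∑ i, w i * ((n i).1 + (n i).2)
  map_zero' := by simp
  map_add' n n' := by
    rw [← Finset.sum_add_distrib]
    refine Finset.sum_congr rfl fun i _ => ?_
    simp only [Pi.add_apply, Prod.fst_add, Prod.snd_add]
    ring

omit [CharZero K] in
lemma levelHom_apply (w : Fin r → K) (n : Fin r → Idx K) :
    levelHom w n = ∑ i, w i * ((n i).1 + (n i).2) := rfl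

omit [CharZero K] in
lemma levelHom_single (w : Fin r → K) (i : Fin r) (x : Idx K) :
    levelHom w (Pi.single i x) = w i * (x.1 + x.2) := by
  rw [levelHom_apply, Finset.sum_eq_single i]
  · simp
  · intro k _ hk
    simp [hk]
  · exact fun h => absurd (Finset.mem_univ _) h

omit [CharZero K] in
lemma levelHom_pairDelta (w : Fin r → K) (p : Pairs r) (z : ℤ × ℤ) :
    levelHom w (pairDelta K p z) = (w p.1.2 - w p.1.1) * (z.1 + z.2) := by
  have h : pairDelta K p z = Pi.single p.1.2 ((z.1 : K), (z.2 : K)) -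
      Pi.single p.1.1 ((z.1 : K), (z.2 : K)) := rfl
  rw [h, map_sub, levelHom_single, levelHom_single, sub_mul]

omit [CharZero K] in
lemma levelHom_shiftBy (w : Fin r → K) (κ : Pairs r → ℕ × ℕ) :
    levelHom w (shiftBy (pairDelta K) κ) =
      ∑ p, (w p.1.2 - w p.1.1) * ((κ p).1 + (κ p).2) := by
  simp [shiftBy, levelHom_pairDelta, castPair]

lemma finite_setOf_weightedSum_eq {ι : Type*} [Fintype ι] (w : ι → ℕ) (y : K) :
    {κ : ι → ℕ × ℕ | (∀ p, w p = 0 → κ p = 0) ∧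
      ∑ p, (w p : K) * ((κ p).1 + (κ p).2) = y}.Finite := by
  rcases Set.eq_empty_or_nonempty {κ : ι → ℕ × ℕ | (∀ p, w p = 0 → κ p = 0) ∧
      ∑ p, (w p : K) * ((κ p).1 + (κ p).2) = y} with h | ⟨κ₀, -, hκ₀⟩
  · simp [h]
  set N := ∑ p, w p * ((κ₀ p).1 + (κ₀ p).2) with hN
  refine (Set.finite_Iic fun _ => (N, N)).subset fun κ hκ p => ?_
  have hsum : ∑ p, w p * ((κ p).1 + (κ p).2) = N := by
    have := hκ.2.trans hκ₀.symm
    exact_mod_cast this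
  by_cases hw : w p = 0
  · rw [hκ.1 p hw]
    exact ⟨Nat.zero_le _, Nat.zero_le _⟩
  · have hle : w p * ((κ p).1 + (κ p).2) ≤ N := by
      rw [← hsum]
      exact Finset.single_le_sum (f := fun p => w p * ((κ p).1 + (κ p).2))
        (fun _ _ => Nat.zero_le _) (Finset.mem_univ p)
    have := Nat.le_mul_of_pos_left ((κ p).1 + (κ p).2) (Nat.pos_of_ne_zero hw)
    exact ⟨by change (κ p).1 ≤ N; omega, by change (κ p).2 ≤ N; omega⟩

lemma finite_setOf_levelHom_shiftBy_eq {w : Fin r → ℕ} {T : Finset (Pairs r)}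
    (hw : ∀ p ∈ T, w p.1.1 < w p.1.2) (y : K) :
    {κ : Pairs r → ℕ × ℕ | (∀ p ∉ T, κ p = 0) ∧
      levelHom (fun i => (w i : K)) (shiftBy (pairDelta K) κ) = y}.Finite := by
  refine (finite_setOf_weightedSum_eq (fun p : Pairs r => if p ∈ T then w p.1.2 - w p.1.1 else 0)
    y).subset fun κ hκ => ⟨fun p hp => ?_, ?_⟩
  · by_contra hne
    have hpT : p ∈ T := by
      by_contra hpT
      exact hne (hκ.1 p hpT)
    have := hw p hpT
    simp only [hpT, if_true] at hp
    omega
  · rw [← hκ.2, levelHom_shiftBy]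
    refine Finset.sum_congr rfl fun p _ => ?_
    by_cases hpT : p ∈ T
    · simp only [hpT, if_true]
      rw [Nat.cast_sub (hw p hpT).le]
    · simp [hpT, hκ.1 p hpT]

/-- The distributions with finitely many nonzero coefficients in each total degree. -/
def degreewiseFinite (K : Type*) [Field K] (V : Type*) [AddCommGroup V] (r : ℕ) :
    AddSubgroup (DistN K V r) where
  carrier := {u | ∀ D : K, {n | u n ≠ 0 ∧ levelHom 1 n = D}.Finite}
  zero_mem' D := by simp
  add_mem' {u v} hu hv D := by
    refine ((hu D).union (hv D)).subset fun n hn => ?_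
    by_cases h : u n = 0
    · exact Or.inr ⟨fun h' => hn.1 (by simp [h, h']), hn.2⟩
    · exact Or.inl ⟨h, hn.2⟩
  neg_mem' {u} hu D := by simpa using hu D

omit [CharZero K] [Module K V] in
lemma mem_degreewiseFinite_shift {u : DistN K V r} (hu : u ∈ degreewiseFinite K V r)
    (x : Fin r → Idx K) : (fun n => u (n + x)) ∈ degreewiseFinite K V r := by
  intro D
  refine ((hu (D + levelHom 1 x)).preimage (add_left_injective x).injOn).subset
    fun n hn => ⟨hn.1, ?_⟩
  rw [map_add, hn.2]

omit [Module K V] in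
lemma InLatN.mem_degreewiseFinite {u : DistN K V r} (hu : InLatN K V u) :
    u ∈ degreewiseFinite K V r := by
  obtain ⟨S, hS⟩ := hu
  intro D
  have hfin : ∀ m : Fin r → Idx K, {n : Fin r → Idx K | (∀ i, IsNegInt K ((n i).1 - (m i).1) ∧
      IsNegInt K ((n i).2 - (m i).2)) ∧ levelHom 1 n = D}.Finite := by
    intro m
    refine ((finite_setOf_weightedSum_eq (fun _ : Fin r => 1) (levelHom 1 m - D)).image
      fun κ i => ((m i).1 - ((κ i).1 : K), (m i).2 - ((κ i).2 : K))).subset fun n hn => ?_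
    have hneg : ∀ x : K, IsNegInt K x → ∃ k : ℕ, x = -(k : K) := by
      rintro _ ⟨k, hk, rfl⟩
      refine ⟨(-k).toNat, ?_⟩
      have : (((-k).toNat : ℤ) : K) = ((-k : ℤ) : K) := by
        rw [Int.toNat_of_nonneg (by omega)]
      push_cast at this
      rw [this, neg_neg]
    choose κ₁ hκ₁ using fun i => hneg _ (hn.1 i).1
    choose κ₂ hκ₂ using fun i => hneg _ (hn.1 i).2
    refine ⟨fun i => (κ₁ i, κ₂ i), ⟨fun _ h => absurd h one_ne_zero, ?_⟩, ?_⟩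
    · rw [← hn.2, levelHom_apply, levelHom_apply, ← Finset.sum_sub_distrib]
      refine Finset.sum_congr rfl fun i _ => ?_
      simp only [Nat.cast_one, Pi.one_apply]
      linear_combination hκ₁ i + hκ₂ i
    · funext i
      ext
      · simp only
        linear_combination -hκ₁ i
      · simp only
        linear_combination -hκ₂ i
  refine (S.finite_toSet.biUnion fun m _ => hfin m).subset fun n hn => ?_
  obtain ⟨m, hm, hnm⟩ := hS n hn.1
  exact Set.mem_biUnion hm ⟨hnm, hn.2⟩

omit [Module K V] in
lemma IsPowN.mem_degreewiseFinite {u : DistN K V r} (hu : IsPowN K V u) :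
    u ∈ degreewiseFinite K V r :=
  InLatN.mem_degreewiseFinite ⟨{0}, fun n hn => ⟨0, by simp, by simpa using hu n hn⟩⟩

omit [CharZero K] in
lemma levelHom_one_shiftBy (κ : Pairs r → ℕ × ℕ) :
    levelHom 1 (shiftBy (pairDelta K) κ) = 0 := by
  simp [levelHom_shiftBy]

omit [Module K V] in
lemma finite_setOf_shiftBy {u : DistN K V r} (hu : u ∈ degreewiseFinite K V r)
    (m : Fin r → Idx K) : {κ | u (m + shiftBy (pairDelta K) κ) ≠ 0}.Finite := by
  refine ((hu (levelHom 1 m)).biUnion fun n _ =>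
    finite_setOf_levelHom_shiftBy_eq (w := fun i : Fin r => (i : ℕ)) (T := Finset.univ)
      (fun p _ => p.2) (levelHom (fun i => ((i : ℕ) : K)) n -
        levelHom (fun i => ((i : ℕ) : K)) m)).subset fun κ hκ => ?_
  refine Set.mem_biUnion (x := m + shiftBy (pairDelta K) κ) ⟨hκ, ?_⟩ ⟨by simp, ?_⟩
  · rw [map_add, levelHom_one_shiftBy, add_zero]
  · rw [map_add, add_sub_cancel_left]

omit [Module K V] in
lemma exists_reachSet_finite (S : Finset (Pairs r)) (hS : S.Nonempty) :
    ∃ j ∈ S, ∀ u ∈ degreewiseFinite K V r, ∀ m,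
      (reachSet (pairDelta K) u j (S.erase j) m).Finite := by
  obtain ⟨j, hj, hmin⟩ := S.exists_min_image (fun p => toLex p.1) hS
  refine ⟨j, hj, fun u hu m => ?_⟩
  set w : Fin r → ℕ := fun i => if i = j.1.1 then j.1.2 else i with hw
  have hwj : w j.1.2 = w j.1.1 := by simp [hw]
  have hwT : ∀ p ∈ S.erase j, w p.1.1 < w p.1.2 := by
    intro p hp
    have hlt : toLex j.1 < toLex p.1 := by
      refine lt_of_le_of_ne (hmin p (Finset.mem_of_mem_erase hp)) fun h => ?_
      exact Finset.ne_of_mem_erase hp (Subtype.ext (toLex.injective h)).symm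
    have hp2 := p.2
    rcases (Prod.Lex.toLex_lt_toLex).mp hlt with h | ⟨h, h'⟩
    · simpa [hw, h.ne', (h.trans hp2).ne'] using hp2
    · simpa [hw, ← h, (h ▸ hp2).ne'] using h'
  have hset : ∀ n, {x : (ℤ × ℤ) × (Pairs r → ℕ × ℕ) | (∀ p ∉ S.erase j, x.2 p = 0) ∧
      m + pairDelta K j x.1 + shiftBy (pairDelta K) x.2 = n}.Finite := by
    intro n
    refine Set.Finite.of_finite_image (f := Prod.snd)
      ((finite_setOf_levelHom_shiftBy_eq hwT (levelHom (fun i => (w i : K)) n -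
        levelHom (fun i => (w i : K)) m)).subset ?_) ?_
    · rintro _ ⟨x, ⟨hx, rfl⟩, rfl⟩
      refine ⟨hx, ?_⟩
      rw [map_add, map_add, levelHom_pairDelta, hwj, sub_self, zero_mul, add_zero,
        add_sub_cancel_left]
    · rintro ⟨z, κ⟩ hx ⟨z', κ'⟩ hx' (rfl : κ = κ')
      have heq := hx.2.trans hx'.2.symm
      exact Prod.ext (pairDelta_injective j (add_left_cancel (add_right_cancel heq))) rfl
  refine ((hu (levelHom 1 m)).biUnion fun n _ => hset n).subset fun x hx => ?_
  refine Set.mem_biUnion (x := m + pairDelta K j x.1 + shiftBy (pairDelta K) x.2)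
    ⟨hx.2, ?_⟩ ⟨hx.1, rfl⟩
  rw [map_add, map_add, levelHom_one_shiftBy, levelHom_pairDelta]
  simp

lemma permMul_one_support_finite (hs : Pairs r → Idx K) {u : DistN K V r}
    (hu : u ∈ degreewiseFinite K V r) (m : Fin r → Idx K) :
    (Function.support fun κ : Pairs r → ℕ × ℕ => (∏ p, pairCoef K (hs p) false (κ p)) •
      u (m + pairOffset hs + shiftBy (pairDelta K) κ)).Finite :=
  (finite_setOf_shiftBy hu (m + pairOffset hs)).subset fun _ hκ => right_ne_zero_of_smul hκ

lemma permMul_one_sub (hs : Pairs r → Idx K) {u v : DistN K V r}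
    (hu : u ∈ degreewiseFinite K V r) (hv : v ∈ degreewiseFinite K V r) (m : Fin r → Idx K) :
    permMul K V 1 hs (u - v) m = permMul K V 1 hs u m - permMul K V 1 hs v m := by
  simp only [permMul_one_apply, Pi.sub_apply, smul_sub]
  exact finsum_sub_distrib (permMul_one_support_finite hs hu m)
    (permMul_one_support_finite hs hv m)

lemma permMul_one_sum (hs : Pairs r → Idx K) {ι : Type*} [Fintype ι] {u : ι → DistN K V r}
    (hu : ∀ i, u i ∈ degreewiseFinite K V r) (m : Fin r → Idx K) :
    permMul K V 1 hs (∑ i, u i) m = ∑ i, permMul K V 1 hs (u i) m := by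
  simp only [permMul_one_apply, Finset.sum_apply, Finset.smul_sum]
  exact finsum_sum_comm _ _ fun i _ => permMul_one_support_finite hs (hu i) m

/-- The prefactors of a reduced OPE are independent over the distributions of degreewise
finite support. -/
theorem eq_zero_of_sum_permMul_one {s : Pairs r → Type*} [∀ p, Fintype (s p)]
    {β : ∀ p, s p → Idx K} (hβ : ∀ p k l, k ≠ l → ¬ IsIntPair K (β p k - β p l))
    {d : (∀ p, s p) → DistN K V r} (hd : ∀ α, d α ∈ degreewiseFinite K V r)
    (h : ∀ m, ∑ α, permMul K V 1 (fun p => β p (α p)) (d α) m = 0) (α : ∀ p, s p) :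
    d α = 0 := by
  simp only [permMul_one_eq_stageTerm] at h
  funext m
  have h0 := eq_zero_of_sum_stageTerm_univ hβ (fun S hS => ?_) h α
    (m - pairOffset fun p => β p (α p))
  · simpa using h0
  · obtain ⟨j, hj, hfin⟩ := exists_reachSet_finite (K := K) (V := V) S hS
    exact ⟨j, hj, fun α m => hfin _ (mem_degreewiseFinite_shift (hd α) _) m⟩

end Pairs

section LastVariable

variable {K : Type*} [Field K] [CharZero K] {V : Type*} [AddCommGroup V] [Module K V] {r : ℕ}

def castSuccPair (p : Pairs r) : Pairs (r + 1) :=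
  ⟨(p.1.1.castSucc, p.1.2.castSucc), p.2⟩

def lastPair (i : Fin r) : Pairs (r + 1) :=
  ⟨(i.castSucc, Fin.last r), Fin.castSucc_lt_last i⟩

lemma sumElim_pair_bijective :
    Function.Bijective (Sum.elim castSuccPair lastPair : Pairs r ⊕ Fin r → Pairs (r + 1)) := by
  constructor
  · rintro (⟨⟨i, j⟩, hij⟩ | i) (⟨⟨k, l⟩, hkl⟩ | k) h <;>
      simp [castSuccPair, lastPair, Subtype.ext_iff, Prod.ext_iff] at h ⊢
    · exact h
    · exact absurd h.2.symm (Fin.castSucc_lt_last _).ne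
    · exact h
  · rintro ⟨⟨i, j⟩, hij⟩
    induction j using Fin.lastCases with
    | last =>
      obtain ⟨i, rfl⟩ := Fin.exists_castSucc_eq.mpr hij.ne
      exact ⟨Sum.inr i, rfl⟩
    | cast j =>
      obtain ⟨i, rfl⟩ := Fin.exists_castSucc_eq.mpr
        (hij.trans (Fin.castSucc_lt_last j)).ne
      exact ⟨Sum.inl ⟨(i, j), hij⟩, rfl⟩

/-- The pairs in `[r + 1]` are those in `[r]` together with those containing the last index. -/
def pairsSuccEquiv (r : ℕ) : Pairs r ⊕ Fin r ≃ Pairs (r + 1) :=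
  Equiv.ofBijective _ sumElim_pair_bijective

def pairsPiEquiv (s : Pairs (r + 1) → Type*) :
    (∀ p : Pairs r, s (castSuccPair p)) × (∀ i : Fin r, s (lastPair i)) ≃ ∀ p, s p :=
  (Equiv.sumPiEquivProdPi fun q => s (pairsSuccEquiv r q)).symm.trans
    (Equiv.piCongrLeft s (pairsSuccEquiv r))

lemma pairsPiEquiv_castSuccPair (s : Pairs (r + 1) → Type*)
    (x : (∀ p : Pairs r, s (castSuccPair p)) × (∀ i : Fin r, s (lastPair i))) (p : Pairs r) :
    pairsPiEquiv s x (castSuccPair p) = x.1 p :=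
  Equiv.piCongrLeft_apply_apply s (pairsSuccEquiv r)
    ((Equiv.sumPiEquivProdPi fun q => s (pairsSuccEquiv r q)).symm x) (Sum.inl p)

lemma pairsPiEquiv_lastPair (s : Pairs (r + 1) → Type*)
    (x : (∀ p : Pairs r, s (castSuccPair p)) × (∀ i : Fin r, s (lastPair i))) (i : Fin r) :
    pairsPiEquiv s x (lastPair i) = x.2 i :=
  Equiv.piCongrLeft_apply_apply s (pairsSuccEquiv r)
    ((Equiv.sumPiEquivProdPi fun q => s (pairsSuccEquiv r q)).symm x) (Sum.inr i)

@[to_additive]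
lemma prod_pairs_succ {M : Type*} [CommMonoid M] (F : Pairs (r + 1) → M) :
    ∏ p, F p = (∏ p : Pairs r, F (castSuccPair p)) * ∏ i : Fin r, F (lastPair i) := by
  rw [← Equiv.prod_comp (pairsSuccEquiv r), Fintype.prod_sum_type]
  rfl

omit [CharZero K] in
lemma pairShift_castSuccPair_castSucc (p : Pairs r) (h : Idx K) (κ : ℕ × ℕ) (i : Fin r) :
    pairShift K (castSuccPair p) h false κ i.castSucc = pairShift K p h false κ i := by
  simp [pairShift, castSuccPair]

omit [CharZero K] in
lemma pairShift_castSuccPair_last (p : Pairs r) (h : Idx K) (κ : ℕ × ℕ) :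
    pairShift K (castSuccPair p) h false κ (Fin.last r) = 0 := by
  simp [pairShift, castSuccPair, (Fin.castSucc_lt_last _).ne']

lemma sum_pairShift_lastPair_castSucc (h : Fin r → Idx K) (i : Fin r) :
    ∑ j, pairShift K (lastPair j) (h j) false 0 i.castSucc = h i := by
  rw [Finset.sum_eq_single i]
  · simp [pairShift, lastPair]
  · intro j _ hj
    simp [pairShift, lastPair, hj.symm, (Fin.castSucc_lt_last _).ne]
  · exact fun hi => absurd (Finset.mem_univ _) hi

omit [CharZero K] in
lemma pairShift_lastPair_last (j : Fin r) (h : Idx K) (κ : ℕ × ℕ) :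
    pairShift K (lastPair j) h false κ (Fin.last r) = ((κ.1 : K), (κ.2 : K)) := by
  simp [pairShift, lastPair, (Fin.castSucc_lt_last _).ne']

lemma eq_zero_of_isNegInt_neg_one_add {n : ℕ} (h : IsNegInt K (-1 + (n : K))) : n = 0 := by
  obtain ⟨k, hk, hkn⟩ := h
  have : k = -1 + (n : ℤ) := by exact_mod_cast hkn
  omega

lemma pairCoef_zero (h : Idx K) : pairCoef K h false 0 = 1 := by
  simp [pairCoef, gchoose_zero]

/-- On a power series, extracting the constant term in the last variable replaces the binomials
in pairs containing the last variable by their leading monomials. -/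
lemma permMul_one_snoc (hs : Pairs (r + 1) → Idx K) {u : DistN K V (r + 1)}
    (hu : IsPowN K V u) (m : Fin r → Idx K) :
    permMul K V 1 hs u (Fin.snoc (α := fun _ => Idx K) m (-1, -1)) =
      permMul K V 1 (fun p => hs (castSuccPair p)) (fun n =>
        u (Fin.snoc (α := fun _ => Idx K) (fun i => n i + hs (lastPair i)) (-1, -1))) m := by
  simp only [permMul, flipOf_one]
  set φ : (Pairs r → ℕ × ℕ) → Pairs (r + 1) → ℕ × ℕ :=
    fun κ => pairsPiEquiv (fun _ => ℕ × ℕ) (κ, 0) with hφ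
  have hφ_inj : Function.Injective φ := fun κ κ' h =>
    congrArg Prod.fst ((pairsPiEquiv fun _ => ℕ × ℕ).injective h)
  have hφc : ∀ κ p, φ κ (castSuccPair p) = κ p := fun κ p =>
    pairsPiEquiv_castSuccPair (fun _ => ℕ × ℕ) (κ, 0) p
  have hφl : ∀ κ i, φ κ (lastPair i) = 0 := fun κ i =>
    pairsPiEquiv_lastPair (fun _ => ℕ × ℕ) (κ, 0) i
  rw [← finsum_comp_of_injective hφ_inj]
  · refine finsum_congr fun κ => ?_
    congr 1
    · rw [prod_pairs_succ]
      simp only [hφc, hφl, pairCoef_zero, Finset.prod_const_one, mul_one]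
    · congr 1
      funext i
      rw [sum_pairs_succ]
      simp only [hφc, hφl]
      induction i using Fin.lastCases with
      | last =>
        simp [pairShift_castSuccPair_last, pairShift_lastPair_last]
      | cast i =>
        rw [Fin.snoc_castSucc, Fin.snoc_castSucc, sum_pairShift_lastPair_castSucc
          (fun j => hs (lastPair j))]
        simp only [pairShift_castSuccPair_castSucc, add_assoc]
  · intro κ hκ
    have hlast := hu _ (right_ne_zero_of_smul hκ) (Fin.last r)
    simp only [Fin.snoc_last, sum_pairs_succ, pairShift_castSuccPair_last,
      pairShift_lastPair_last, Finset.sum_const_zero, zero_add, Prod.fst_add, Prod.snd_add,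
      Prod.fst_sum, Prod.snd_sum, ← Nat.cast_sum] at hlast
    have h1 := eq_zero_of_isNegInt_neg_one_add hlast.1
    have h2 := eq_zero_of_isNegInt_neg_one_add hlast.2
    simp only [Finset.sum_eq_zero_iff, Finset.mem_univ, true_imp_iff] at h1 h2
    refine ⟨fun p => κ (castSuccPair p), ?_⟩
    rw [hφ, ← Equiv.eq_symm_apply]
    refine Prod.ext (funext fun p => ?_) (funext fun i => ?_)
    · rfl
    · exact (Prod.ext (h1 i) (h2 i)).symm

omit [CharZero K] in
lemma koszulPerm_one (ps : Fin r → ZMod 2) : koszulPerm K ps 1 = 1 := by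
  refine Finset.prod_eq_one fun p _ => if_neg fun h => ?_
  exact absurd h.1 (not_lt.mpr p.2.le)

omit [CharZero K] in
lemma compSeq_one_snoc (a : Fin (r + 1) → EDist1 K V) (m : Fin r → Idx K) (k : Idx K) (v : V) :
    compSeq K V a 1 (Fin.snoc (α := fun _ => Idx K) m k) v =
      compSeq K V (fun i => a i.castSucc) 1 m (a (Fin.last r) k v) := by
  have h : (List.ofFn fun i : Fin r => i.castSucc) =
      (List.ofFn fun i : Fin r => i).map Fin.castSucc := by
    rw [List.map_ofFn]
    rfl
  simp only [compSeq, Equiv.Perm.coe_one, id_eq]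
  rw [List.ofFn_succ', List.concat_eq_append, List.foldr_append, h, List.foldr_map]
  simp

omit [CharZero K] [Module K V] in
lemma IsPowN.snoc {u : DistN K V (r + 1)} (hu : IsPowN K V u) (k : Idx K) :
    IsPowN K V fun n => u (Fin.snoc (α := fun _ => Idx K) n k) := by
  intro n hn i
  simpa using hu _ hn i.castSucc

lemma sum_permMul_one_snoc {s : Pairs (r + 1) → Type*} [∀ p, Fintype (s p)]
    (β : ∀ p, s p → Idx K) {u : (∀ p, s p) → DistN K V (r + 1)} (hu : ∀ γ, IsPowN K V (u γ))
    (m : Fin r → Idx K) :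
    ∑ γ, permMul K V 1 (fun p => β p (γ p)) (u γ)
        (Fin.snoc (α := fun _ => Idx K) m (-1, -1)) =
      ∑ α : ∀ p : Pairs r, s (castSuccPair p),
        permMul K V 1 (fun p => β (castSuccPair p) (α p))
          (∑ κ : ∀ i : Fin r, s (lastPair i), fun n => u (pairsPiEquiv s (α, κ))
            (Fin.snoc (α := fun _ => Idx K) (fun i => n i + β (lastPair i) (κ i)) (-1, -1)))
          m := by
  rw [← Equiv.sum_comp (pairsPiEquiv s), Fintype.sum_prod_type]
  refine Finset.sum_congr rfl fun α _ => ?_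
  rw [permMul_one_sum]
  · refine Finset.sum_congr rfl fun κ _ => ?_
    rw [permMul_one_snoc _ (hu _)]
    simp only [pairsPiEquiv_castSuccPair, pairsPiEquiv_lastPair]
  · exact fun κ => mem_degreewiseFinite_shift ((hu _).snoc (-1, -1)).mem_degreewiseFinite
      fun i => β (lastPair i) (κ i)

end LastVariable

/-- in a uniformly local OPE-algebra, for a reduced multiple OPE
of a¹(𝐳),…,aʳ(𝐳) with c^α(𝐳₁,…,𝐳ᵣ)1 a power series, each c^α(𝐳₁,…,𝐳ᵣ)a lies in
Σ_κ 𝐳₁^{−𝐡_{a¹a}^{κ(1)}}⋯𝐳ᵣ^{−𝐡_{aʳa}^{κ(r)}}·V[[𝐳₁,…,𝐳ᵣ]]. -/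
theorem stmt_16 (K : Type*) [Field K] [CharZero K]
    (V : Type*) [AddCommGroup V] [Module K V]
    (A : OPEAlg K V)
    (rr : V → V → ℕ) (hh : ∀ a b : V, Fin (rr a b) → Idx K)
    (hu : ∀ (r : ℕ) (f : Fin r → V) (pf : Fin r → ZMod 2),
      (∀ i, memPar K A.ev A.od (f i) (pf i)) →
        ∃ c, IsMultOPE K V (fun i => A.Y (f i)) pf (fun i j => rr (f i) (f j))
            (fun i j => hh (f i) (f j)) c ∧
          ∀ α, IsPowN K V (evN K V (c α) A.one))
    (aa : V) (paa : ZMod 2) (hpaa : memPar K A.ev A.od aa paa)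
    {r : ℕ} (f : Fin r → V) (pf : Fin r → ZMod 2)
    (hpf : ∀ i, memPar K A.ev A.od (f i) (pf i))
    (c : ((p : Pairs r) → Fin (rr (f p.1.1) (f p.1.2))) → EDistN K V r)
    (hc : IsMultOPE K V (fun i => A.Y (f i)) pf (fun i j => rr (f i) (f j))
        (fun i j => hh (f i) (f j)) c)
    (hred : ∀ i j k l, k ≠ l → ¬ IsIntPair K (hh (f i) (f j) k - hh (f i) (f j) l))
    (hpow : ∀ α, IsPowN K V (evN K V (c α) A.one)) :
    ∀ α, ∃ g : ((i : Fin r) → Fin (rr (f i) aa)) → DistN K V r,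
      (∀ κ, IsPowN K V (g κ)) ∧
      ∀ m : Fin r → Idx K,
        c α m aa =
          ∑ κ : (i : Fin r) → Fin (rr (f i) aa),
            g κ (fun i => ((m i).1 - (hh (f i) aa (κ i)).1,
                           (m i).2 - (hh (f i) aa (κ i)).2)) := by
  obtain ⟨f', rfl, rfl⟩ : ∃ f' : Fin (r + 1) → V,
      f = (fun i => f' i.castSucc) ∧ aa = f' (Fin.last r) :=
    ⟨Fin.snoc (α := fun _ => V) f aa, by simp, by simp⟩
  obtain ⟨pf', rfl, rfl⟩ : ∃ pf' : Fin (r + 1) → ZMod 2,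
      pf = (fun i => pf' i.castSucc) ∧ paa = pf' (Fin.last r) :=
    ⟨Fin.snoc (α := fun _ => ZMod 2) pf paa, by simp, by simp⟩
  obtain ⟨c', hc', hpow'⟩ := hu (r + 1) f' pf' fun i => Fin.lastCases hpaa hpf i
  set s : Pairs (r + 1) → Type := fun p => Fin (rr (f' p.1.1) (f' p.1.2))
  set g : ((p : Pairs r) → s (castSuccPair p)) → ((i : Fin r) → s (lastPair i)) → DistN K V r :=
    fun α κ n => evN K V (c' (pairsPiEquiv s (α, κ))) A.one
      (Fin.snoc (α := fun _ => Idx K) n (-1, -1))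
  have hgpow : ∀ α κ, IsPowN K V (g α κ) := fun α κ => (hpow' _).snoc (-1, -1)
  set G : ((p : Pairs r) → s (castSuccPair p)) → DistN K V r := fun α =>
    ∑ κ : (i : Fin r) → s (lastPair i),
      fun n => g α κ (n + fun i => -hh (f' i.castSucc) (f' (Fin.last r)) (κ i))
  have hGfin : ∀ α, G α ∈ degreewiseFinite K V r := fun α => sum_mem fun κ _ =>
    mem_degreewiseFinite_shift (hgpow α κ).mem_degreewiseFinite _
  have hcfin : ∀ α, evN K V (c α) (f' (Fin.last r)) ∈ degreewiseFinite K V r := fun α =>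
    (hc.2.1 α _).mem_degreewiseFinite
  have hrel : ∀ m, ∑ α, permMul K V 1
      (fun p => -hh (f' p.1.1.castSucc) (f' p.1.2.castSucc) (α p))
      (evN K V (c α) (f' (Fin.last r)) - G α) m = 0 := by
    intro m
    have h1 := hc.2.2 1 (f' (Fin.last r)) m
    have h2 := hc'.2.2 1 A.one (Fin.snoc (α := fun _ => Idx K) m (-1, -1))
    rw [koszulPerm_one, one_smul] at h1 h2
    rw [compSeq_one_snoc, A.rid, h1] at h2
    have h3 := sum_permMul_one_snoc (s := s) (fun p k => -hh (f' p.1.1) (f' p.1.2) k)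
      (u := fun γ => evN K V (c' γ) A.one) hpow' m
    refine (Finset.sum_congr rfl fun α _ =>
      permMul_one_sub _ (hcfin α) (hGfin α) m).trans ((Finset.sum_sub_distrib _ _).trans ?_)
    exact sub_eq_zero.mpr (h2.trans h3)
  intro α
  have hα := eq_zero_of_sum_permMul_one (s := fun p : Pairs r => s (castSuccPair p))
    (β := fun p k => -hh (f' p.1.1.castSucc) (f' p.1.2.castSucc) k) (fun p k l hkl hint => ?_)
    (fun α => sub_mem (hcfin α) (hGfin α)) hrel α
  · refine ⟨g α, hgpow α, fun m => ?_⟩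
    have := sub_eq_zero.mp (congrFun hα m)
    refine this.trans ((Finset.sum_apply m Finset.univ _).trans ?_)
    refine Finset.sum_congr rfl fun κ _ => congrArg (g α κ) ?_
    funext i
    ext <;> simp [sub_eq_add_neg]
  · refine hred p.1.1 p.1.2 l k hkl.symm ?_
    simpa [neg_add_eq_sub] using hint

end OPEA
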